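/- Let p>−1 and q be real, and let λ₁, λ₂ be complex with Re λ₁ > (1+p+q)/2, Re λ₂ < 1+p, and λ₁, λ₁−q not nonpositive integers. Then for all purely imaginary α, the integral ∫₀¹ w_{p,q}(x)·x^{λ₁}·(1−x)^{−λ₂}·ϑ_α^{(p,q)}(x) dx converges absolutely and equals [Γ(1+p)·Γ(λ₁−(1+p+q)/2+α)·Γ(λ₁−(1+p+q)/2−α) / (Γ(λ₁)·Γ(λ₁−q))] · ₃F₂(λ₁−(1+p+q)/2+α, λ₁−(1+p+q)/2−α, λ₂; λ₁, λ₁−q; 1), where the ₃F₂ series converges absolutely because Re(1+p−λ₂)>0. -/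

import Mathlib

open scoped Real
open Complex MeasureTheory Set ComplexConjugate

noncomputable section

/-- Pochhammer symbol `(a)ₙ = a (a+1) ⋯ (a+n−1)`. -/
def poch (a : ℂ) (n : ℕ) : ℂ := (ascPochhammer ℂ n).eval a

/-- Gauss hypergeometric series `₂F₁(a,b;c;z)`. -/
def hyp2F1 (a b c z : ℂ) : ℂ :=
  ∑' n : ℕ, poch a n * poch b n / (poch c n * (n.factorial : ℂ)) * z ^ n

/-- Jacobi function `ϑ_α^{(p,q)}(x)` on `0 < x < 1`. -/
def thetaJ (p q α : ℂ) (x : ℝ) : ℂ :=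
  (x : ℂ) ^ ((1 + p + q) / 2 + α) *
    hyp2F1 ((1 + p + q) / 2 + α) ((1 + p - q) / 2 + α) (1 + p) (1 - (x : ℂ))

/-- The weight `w_{p,q}(x) = (1−x)^p x^{−(2+p+q)}`. -/
def wpq (p q : ℝ) (x : ℝ) : ℂ :=
  ((1 - x : ℝ) : ℂ) ^ ((p : ℝ) : ℂ) * (x : ℂ) ^ ((-(2 + p + q) : ℝ) : ℂ)

/-- Generalized hypergeometric sum `₃F₂(a₁,a₂,a₃;b₁,b₂;1)`. -/
def hyp3F2 (a₁ a₂ a₃ b₁ b₂ : ℂ) : ℂ :=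
  ∑' n : ℕ, poch a₁ n * poch a₂ n * poch a₃ n /
    (poch b₁ n * poch b₂ n * (n.factorial : ℂ))

open Filter Topology Asymptotics

lemma poch_zero (a : ℂ) : poch a 0 = 1 := by simp [poch]

lemma poch_succ (a : ℂ) (n : ℕ) : poch a (n + 1) = poch a n * (a + n) := by
  simp [poch, ascPochhammer_succ_eval]

lemma poch_eq_prod (a : ℂ) (n : ℕ) : poch a n = ∏ j ∈ Finset.range n, (a + j) := by
  induction n with
  | zero => simp [poch_zero]
  | succ n ih => rw [poch_succ, ih, Finset.prod_range_succ]

lemma poch_eq_zero_iff (a : ℂ) (n : ℕ) : poch a n = 0 ↔ ∃ k < n, a = -(k : ℂ) := by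
  simp only [poch, ascPochhammer_eval_eq_zero_iff]
  refine exists_congr fun k => and_congr_right fun _ => ?_
  rw [eq_comm, neg_eq_iff_eq_neg]

lemma poch_ne_zero {a : ℂ} (ha : ∀ n : ℕ, a ≠ -(n : ℂ)) (n : ℕ) : poch a n ≠ 0 := by
  rw [Ne, poch_eq_zero_iff]
  exact fun ⟨k, _, h⟩ => ha k h

lemma ne_neg_natCast_of_re_pos {a : ℂ} (ha : 0 < a.re) (n : ℕ) : a ≠ -(n : ℂ) := by
  rintro rfl
  simp only [neg_re, natCast_re, Left.neg_pos_iff] at ha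
  exact absurd ha (Nat.cast_nonneg n).not_gt

lemma Gamma_add_natCast {a : ℂ} (ha : ∀ n : ℕ, a ≠ -(n : ℂ)) (n : ℕ) :
    Gamma (a + n) = poch a n * Gamma a := by
  rw [poch, ← Gamma_add_nat_div_Gamma_eq a ha, div_mul_cancel₀ _ (Gamma_ne_zero ha)]

/-- `(a)ₙ₊₁` in terms of Euler's approximation to `Γ(a)`. -/
lemma GammaSeq_eq_poch (a : ℂ) (n : ℕ) :
    GammaSeq a n = (n : ℂ) ^ a * n.factorial / poch a (n + 1) := by
  rw [GammaSeq, poch_eq_prod]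

/-- `‖(a)ₙ‖ / (n^{Re a - 1} n!)` tends to `1 / ‖Γ(a)‖`. -/
lemma tendsto_norm_poch_div {a : ℂ} (ha : ∀ n : ℕ, a ≠ -(n : ℂ)) :
    Tendsto (fun n : ℕ => ‖poch a n‖ / ((n : ℝ) ^ (a.re - 1) * n.factorial)) atTop
      (𝓝 ‖Gamma a‖⁻¹) := by
  have h1 := ((GammaSeq_tendsto_Gamma a).norm).inv₀ (norm_ne_zero_iff.2 (Gamma_ne_zero ha))
  have h2 : Tendsto (fun n : ℕ => ‖1 + a / (n : ℂ)‖⁻¹) atTop (𝓝 1) := by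
    have := (tendsto_const_div_atTop_nhds_zero_nat a).const_add 1
    simpa using this.norm.inv₀ (by simp)
  have h3 := h1.mul h2
  rw [mul_one] at h3
  refine h3.congr' ?_
  filter_upwards [eventually_gt_atTop 0] with n hn
  have hn' : (0 : ℝ) < n := by exact_mod_cast hn
  have hn'' : (n : ℂ) ≠ 0 := by exact_mod_cast hn.ne'
  have e1 : 1 + a / (n : ℂ) = (a + n) / n := by field_simp; ring
  have e2 : ‖(n : ℂ) ^ a‖ = (n : ℝ) ^ a.re := by
    simpa using norm_cpow_eq_rpow_re_of_pos hn' a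
  have e3 : ‖a + n‖ ≠ 0 := norm_ne_zero_iff.2 fun h => ha n (eq_neg_of_add_eq_zero_left h)
  rw [GammaSeq_eq_poch, e1, poch_succ, Real.rpow_sub hn', Real.rpow_one]
  simp only [norm_div, norm_mul, e2, norm_natCast, Complex.norm_natCast]
  have e4 : (n : ℝ) ^ a.re ≠ 0 := (Real.rpow_pos_of_pos hn' _).ne'
  have e5 : (n.factorial : ℝ) ≠ 0 := by positivity
  field_simp

lemma eventually_rpow_mul_factorial_pos (s : ℝ) :
    ∀ᶠ n : ℕ in atTop, 0 < (n : ℝ) ^ s * (n.factorial : ℝ) := by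
  filter_upwards [eventually_gt_atTop 0] with n hn
  positivity

lemma poch_isBigO (a : ℂ) :
    (poch a) =O[atTop] fun n : ℕ => (n : ℝ) ^ (a.re - 1) * (n.factorial : ℝ) := by
  by_cases ha : ∀ n : ℕ, a ≠ -(n : ℂ)
  · refine IsBigO.of_norm_left (isBigO_of_div_tendsto_nhds ?_ _ (tendsto_norm_poch_div ha))
    filter_upwards [eventually_rpow_mul_factorial_pos (a.re - 1)] with n hn h
    exact absurd h hn.ne'
  · push Not at ha
    obtain ⟨k, hk⟩ := ha
    refine EventuallyEq.trans_isBigO (f₂ := fun _ => (0 : ℂ)) ?_ (isBigO_zero _ _)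
    filter_upwards [eventually_gt_atTop k] with n hn
    exact (poch_eq_zero_iff a n).2 ⟨k, hn, hk⟩

lemma isBigO_poch {a : ℂ} (ha : ∀ n : ℕ, a ≠ -(n : ℂ)) :
    (fun n : ℕ => (n : ℝ) ^ (a.re - 1) * (n.factorial : ℝ)) =O[atTop] poch a := by
  refine IsBigO.of_norm_right (isBigO_of_div_tendsto_nhds ?_ ‖Gamma a‖ ?_)
  · filter_upwards with n h
    exact absurd h (norm_ne_zero_iff.2 (poch_ne_zero ha n))
  · have := (tendsto_norm_poch_div ha).inv₀ (inv_ne_zero (norm_ne_zero_iff.2 (Gamma_ne_zero ha)))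
    simpa [Pi.div_def] using this

lemma poch_one (n : ℕ) : poch 1 n = n.factorial := by
  simp [poch, ascPochhammer_eval_one]

/-- The `n`-th coefficient of the Gauss series `₂F₁(a,b;c;z)`. -/
def gaussCoeff (a b c : ℂ) (n : ℕ) : ℂ :=
  poch a n * poch b n / (poch c n * (n.factorial : ℂ))

lemma one_ne_neg_natCast (n : ℕ) : (1 : ℂ) ≠ -(n : ℂ) :=
  ne_neg_natCast_of_re_pos (by simp) n

lemma gaussCoeff_isBigO (a b : ℂ) {c : ℂ} (hc : ∀ n : ℕ, c ≠ -(n : ℂ)) :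
    gaussCoeff a b c =O[atTop] fun n : ℕ => (n : ℝ) ^ ((a + b - c).re - 1) := by
  have h := ((poch_isBigO a).mul (poch_isBigO b)).mul
    (((isBigO_poch hc).mul (isBigO_poch one_ne_neg_natCast)).inv_rev ?_)
  · refine (h.congr_left fun n => ?_).trans ?_
    · rw [gaussCoeff, poch_one, div_eq_mul_inv]
    refine IsBigO.of_bound 1 ?_
    filter_upwards [eventually_gt_atTop 0] with n hn
    have hn' : (0 : ℝ) < n := by exact_mod_cast hn
    have hf : (n.factorial : ℝ) ≠ 0 := by positivity
    have key : (n : ℝ) ^ (a.re - 1) * n.factorial * ((n : ℝ) ^ (b.re - 1) * n.factorial) *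
        ((n : ℝ) ^ (c.re - 1) * n.factorial * ((n : ℝ) ^ ((1 : ℂ).re - 1) * n.factorial))⁻¹ =
        (n : ℝ) ^ ((a + b - c).re - 1) := by
      rw [show (a + b - c).re - 1 = (a.re - 1) + (b.re - 1) - (c.re - 1) by simp; ring,
        Real.rpow_sub hn' (a.re - 1 + (b.re - 1)), Real.rpow_add hn' (a.re - 1)]
      have : (n : ℝ) ^ (c.re - 1) ≠ 0 := (Real.rpow_pos_of_pos hn' _).ne'
      simp only [one_re, sub_self, Real.rpow_zero]
      field_simp
    rw [key, one_mul]
  · filter_upwards [eventually_rpow_mul_factorial_pos (c.re - 1),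
      eventually_rpow_mul_factorial_pos ((1 : ℂ).re - 1)] with n h1 h2 h
    exact absurd h (mul_pos h1 h2).ne'

lemma hasSum_poch (a : ℂ) {y : ℝ} (hy : 0 ≤ y) (hy1 : y < 1) :
    HasSum (fun n : ℕ => poch a n / n.factorial * (y : ℂ) ^ n) (((1 - y : ℝ) : ℂ) ^ (-a)) := by
  have hmem : (y : ℂ) ∈ Metric.eball (0 : ℂ) 1 := by
    rw [mem_eball_zero_iff, ← ofReal_norm, ← ENNReal.ofReal_one]
    exact (ENNReal.ofReal_lt_ofReal_iff one_pos).2 (by simpa [abs_of_nonneg hy] using hy1)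
  have h := (Complex.one_div_one_sub_cpow_hasFPowerSeriesOnBall_zero a).hasSum hmem
  rw [show ((1 - y : ℝ) : ℂ) ^ (-a) = 1 / (1 - (0 + (y : ℂ))) ^ a by simp [cpow_neg]]
  have hcoeff (n : ℕ) : poch a n / n.factorial = Ring.choose (a + n - 1) n := by
    have hf : (n.factorial : ℂ) ≠ 0 := by exact_mod_cast n.factorial_ne_zero
    have := Ring.factorial_nsmul_multichoose_eq_ascPochhammer a n
    rw [Polynomial.ascPochhammer_smeval_eq_eval, Ring.multichoose_eq, nsmul_eq_mul] at this
    rw [poch, ← this, mul_div_cancel_left₀ _ hf]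
  simpa [hcoeff, FormalMultilinearSeries.ofScalars_apply_eq, mul_comm] using h

lemma poch_ofReal_eq_norm {s : ℝ} (hs : 0 < s) (n : ℕ) :
    poch (s : ℂ) n = (‖poch (s : ℂ) n‖ : ℝ) := by
  rw [poch_eq_prod, norm_prod, ofReal_prod]
  refine Finset.prod_congr rfl fun j _ => ?_
  rw [← ofReal_natCast, ← ofReal_add, norm_real, Real.norm_of_nonneg (by positivity)]

lemma hasSum_norm_poch {s y : ℝ} (hs : 0 < s) (hy : 0 ≤ y) (hy1 : y < 1) :
    HasSum (fun n : ℕ => ‖poch (s : ℂ) n‖ / n.factorial * y ^ n) ((1 - y) ^ (-s)) := by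
  have h := hasSum_poch (s : ℂ) hy hy1
  rw [← ofReal_neg, ← ofReal_cpow (by linarith)] at h
  rw [← hasSum_ofReal]
  convert h using 2 with n
  rw [poch_ofReal_eq_norm hs]
  push_cast
  simp

/-- Sequences of size `O(n^(s-1))` are dominated by the coefficients of `(1 - y)^(-s)`. -/
lemma exists_bound_poch {u : ℕ → ℂ} {r s : ℝ} (hs : 0 < s) (hr : r ≤ s)
    (hu : u =O[atTop] fun n : ℕ => (n : ℝ) ^ (r - 1)) :
    ∃ C, 0 ≤ C ∧ ∀ n, ‖u n‖ ≤ C * (‖poch (s : ℂ) n‖ / n.factorial) := by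
  have hs' : ∀ n : ℕ, (s : ℂ) ≠ -(n : ℂ) := ne_neg_natCast_of_re_pos (by simpa using hs)
  have h1 : (fun n : ℕ => (n : ℝ) ^ (r - 1)) =O[atTop]
      fun n => poch (s : ℂ) n / (n.factorial : ℂ) := by
    have h2 := (isBigO_poch hs').norm_right
    have h3 : (fun n : ℕ => (n : ℝ) ^ (r - 1)) =O[atTop] fun n : ℕ => (n : ℝ) ^ (s - 1) := by
      refine IsBigO.of_bound 1 ?_
      filter_upwards [eventually_ge_atTop 1] with n hn
      have hn' : (1 : ℝ) ≤ n := by exact_mod_cast hn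
      rw [Real.norm_of_nonneg (by positivity), Real.norm_of_nonneg (by positivity), one_mul]
      exact Real.rpow_le_rpow_of_exponent_le hn' (by linarith)
    refine h3.trans (IsBigO.of_norm_right ?_)
    have h4 := h2.mul (isBigO_refl (fun n : ℕ => ((n.factorial : ℝ))⁻¹) atTop)
    refine h4.congr (fun n => ?_) (fun n => ?_)
    · have : (n.factorial : ℝ) ≠ 0 := by positivity
      simp [this]
    · simp [div_eq_mul_inv]
  obtain ⟨C, hC, h⟩ := bound_of_isBigO_nat_atTop (hu.trans h1)
  refine ⟨C, hC.le, fun n => ?_⟩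
  have := h (x := n) (div_ne_zero (poch_ne_zero hs' n) (by exact_mod_cast n.factorial_ne_zero))
  simpa using this

lemma summable_gaussCoeff {a b c : ℂ} (hc : ∀ n : ℕ, c ≠ -(n : ℂ)) (h : 0 < (c - a - b).re) :
    Summable (gaussCoeff a b c) := by
  refine summable_of_isBigO_nat (Real.summable_nat_rpow.2 ?_) (gaussCoeff_isBigO a b hc)
  simp only [sub_re, add_re] at h ⊢
  linarith

lemma tendsto_natCast_mul_gaussCoeff {a b c : ℂ} (hc : ∀ n : ℕ, c ≠ -(n : ℂ))
    (h : 0 < (c - a - b).re) :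
    Tendsto (fun n : ℕ => (n : ℂ) * gaussCoeff a b c n) atTop (𝓝 0) := by
  have h1 := (isBigO_refl (fun n : ℕ => (n : ℂ)) atTop).norm_right.mul (gaussCoeff_isBigO a b hc)
  refine h1.trans_tendsto ?_
  have h2 := (tendsto_rpow_neg_atTop h).comp tendsto_natCast_atTop_atTop
  refine h2.congr' ?_
  filter_upwards [eventually_gt_atTop 0] with n hn
  have hn' : (0 : ℝ) < n := by exact_mod_cast hn
  rw [Function.comp_apply, norm_natCast, ← Real.rpow_one_add' hn'.le]
  · congr 1
    simp
    ring
  · simp only [sub_re, add_re] at h ⊢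
    linarith

lemma gaussCoeff_succ {a b c : ℂ} (hc : ∀ n : ℕ, c ≠ -(n : ℂ)) (n : ℕ) :
    (c + n) * ((n + 1) * gaussCoeff a b c (n + 1)) = (a + n) * (b + n) * gaussCoeff a b c n := by
  have h1 := poch_ne_zero hc n
  have h2 : c + n ≠ 0 := fun h => hc n (eq_neg_of_add_eq_zero_left h)
  have h3 : (n.factorial : ℂ) ≠ 0 := by exact_mod_cast n.factorial_ne_zero
  have h4 : (n : ℂ) + 1 ≠ 0 := by exact_mod_cast n.succ_ne_zero
  simp only [gaussCoeff, poch_succ, Nat.factorial_succ, Nat.cast_mul, Nat.cast_add, Nat.cast_one]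
  field_simp

lemma poch_add_one_mul (c : ℂ) (n : ℕ) : poch (c + 1) n * c = poch c n * (c + n) := by
  induction n with
  | zero => simp [poch_zero]
  | succ n ih =>
    rw [poch_succ, poch_succ c]
    push_cast
    linear_combination (c + 1 + n) * ih

lemma gaussCoeff_add_one {a b c : ℂ} (hc : ∀ n : ℕ, c ≠ -(n : ℂ)) (n : ℕ) :
    (c + n) * gaussCoeff a b (c + 1) n = c * gaussCoeff a b c n := by
  have h1 := poch_ne_zero hc n
  have h2 : c + n ≠ 0 := fun h => hc n (eq_neg_of_add_eq_zero_left h)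
  have h0 : c ≠ 0 := by simpa using hc 0
  have h3 : poch (c + 1) n ≠ 0 := fun h =>
    mul_ne_zero h1 h2 (by rw [← poch_add_one_mul, h, zero_mul])
  have h4 : (n.factorial : ℂ) ≠ 0 := by exact_mod_cast n.factorial_ne_zero
  have h5 := poch_add_one_mul c n
  simp only [gaussCoeff]
  field_simp
  linear_combination (-poch a n * poch b n) * h5

lemma gaussCoeff_contiguous {a b c : ℂ} (hc : ∀ n : ℕ, c ≠ -(n : ℂ)) (n : ℕ) :
    c * (n * gaussCoeff a b c n - (n + 1 : ℕ) * gaussCoeff a b c (n + 1)) =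
      c * (c - a - b) * gaussCoeff a b c n - (c - a) * (c - b) * gaussCoeff a b (c + 1) n := by
  have h2 : c + n ≠ 0 := fun h => hc n (eq_neg_of_add_eq_zero_left h)
  refine mul_left_cancel₀ h2 ?_
  have e1 := gaussCoeff_succ (a := a) (b := b) hc n
  have e2 := gaussCoeff_add_one (a := a) (b := b) hc n
  push_cast
  linear_combination -c * e1 + (c - a) * (c - b) * e2

lemma tsum_gaussCoeff_add_one {a b c : ℂ} (hc : 0 < c.re) (h : 0 < (c - a - b).re) :
    c * (c - a - b) * ∑' n, gaussCoeff a b c n =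
      (c - a) * (c - b) * ∑' n, gaussCoeff a b (c + 1) n := by
  have hc0 : ∀ n : ℕ, c ≠ -(n : ℂ) := ne_neg_natCast_of_re_pos hc
  have hc1 : ∀ n : ℕ, c + 1 ≠ -(n : ℂ) := ne_neg_natCast_of_re_pos (by simp; linarith)
  have s0 := (summable_gaussCoeff hc0 h).hasSum
  have s1 := (summable_gaussCoeff (a := a) (b := b) hc1 (by simp at h ⊢; linarith)).hasSum
  have s2 := ((s0.mul_left (c * (c - a - b))).sub (s1.mul_left ((c - a) * (c - b)))).tendsto_sum_nat
  have s3 := ((tendsto_natCast_mul_gaussCoeff hc0 h).neg).const_mul c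
  rw [← sub_eq_zero]
  refine tendsto_nhds_unique s2 ?_
  simp only [neg_zero, mul_zero] at s3
  refine s3.congr fun n => ?_
  rw [Finset.sum_congr rfl fun k _ => (gaussCoeff_contiguous hc0 k).symm, ← Finset.mul_sum,
    Finset.sum_range_sub' (fun k : ℕ => (k : ℂ) * gaussCoeff a b c k)]
  simp

lemma tsum_gaussCoeff_add_nat {a b c : ℂ} (hc : 0 < c.re) (h : 0 < (c - a - b).re) (n : ℕ) :
    ∑' k, gaussCoeff a b c k = poch (c - a) n * poch (c - b) n /
      (poch c n * poch (c - a - b) n) * ∑' k, gaussCoeff a b (c + n) k := by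
  induction n with
  | zero => simp [poch_zero]
  | succ n ih =>
    have hcn : 0 < (c + n).re := by simp; positivity
    have hn : 0 < (c + n - a - b).re := by
      have : (0 : ℝ) ≤ n := n.cast_nonneg
      simp at h ⊢; linarith
    have step := tsum_gaussCoeff_add_one hcn hn
    have n1 : c + n ≠ 0 := fun h0 => by simp [h0] at hcn
    have n2 : c - a - b + n ≠ 0 := fun h0 => by
      rw [show c + n - a - b = c - a - b + n by ring, h0] at hn; simp at hn
    have n3 := poch_ne_zero (ne_neg_natCast_of_re_pos hc) n
    have n4 := poch_ne_zero (ne_neg_natCast_of_re_pos h) n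
    rw [ih, poch_succ, poch_succ, poch_succ, poch_succ, Nat.cast_add, Nat.cast_one, ← add_assoc]
    field_simp
    linear_combination (poch (c - a) n * poch (c - b) n) * step

lemma norm_poch_le_norm_poch_add {c : ℂ} (hc : 0 < c.re) (n k : ℕ) :
    ‖poch c k‖ ≤ ‖poch (c + n) k‖ := by
  rw [poch_eq_prod, poch_eq_prod, norm_prod, norm_prod]
  refine Finset.prod_le_prod (fun _ _ => norm_nonneg _) fun j _ => ?_
  have : (0 : ℝ) ≤ j := j.cast_nonneg
  have : (0 : ℝ) ≤ n := n.cast_nonneg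
  rw [norm_def, norm_def, normSq_apply, normSq_apply]
  refine Real.sqrt_le_sqrt ?_
  simp only [add_re, natCast_re, add_im, natCast_im]
  nlinarith

lemma tendsto_norm_poch_add_atTop (c : ℂ) (k : ℕ) :
    Tendsto (fun n : ℕ => ‖poch (c + n) (k + 1)‖) atTop atTop := by
  have hbase : ∀ j : ℕ, Tendsto (fun n : ℕ => ‖c + n + j‖) atTop atTop := fun j => by
    refine tendsto_atTop_mono (f := fun n : ℕ => (n : ℝ) - ‖c + j‖) (fun n => ?_)
      (tendsto_atTop_add_const_right _ _ tendsto_natCast_atTop_atTop)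
    have := norm_sub_le (c + n + j) (c + j)
    rw [show c + n + j - (c + j) = n by ring, norm_natCast] at this
    linarith
  induction k with
  | zero => simpa [poch_succ, poch_zero] using hbase 0
  | succ k ih => simpa only [poch_succ _ (k + 1), norm_mul] using ih.atTop_mul_atTop₀ (hbase (k + 1))

lemma tendsto_tsum_gaussCoeff_add_nat {a b c : ℂ} (hc : 0 < c.re) (h : 0 < (c - a - b).re) :
    Tendsto (fun n : ℕ => ∑' k, gaussCoeff a b (c + n) k) atTop (𝓝 1) := by
  have hlim : ∑' k : ℕ, (if k = 0 then (1 : ℂ) else 0) = 1 := by simp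
  rw [← hlim]
  refine tendsto_tsum_of_dominated_convergence
    (summable_gaussCoeff (ne_neg_natCast_of_re_pos hc) h).norm (fun k => ?_)
    (Eventually.of_forall fun n k => ?_)
  · rcases k with _ | k
    · simp [gaussCoeff, poch_zero]
    · simp only [Nat.add_eq_zero_iff, one_ne_zero, and_false, if_false]
      rw [tendsto_zero_iff_norm_tendsto_zero]
      simp only [gaussCoeff, norm_div, norm_mul]
      exact tendsto_const_nhds.div_atTop ((tendsto_norm_poch_add_atTop c k).atTop_mul_const
        (norm_pos_iff.2 (by exact_mod_cast (k + 1).factorial_ne_zero)))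
  · simp only [gaussCoeff, norm_div, norm_mul]
    have := norm_pos_iff.2 (poch_ne_zero (ne_neg_natCast_of_re_pos hc) k)
    have : 0 < ‖(k.factorial : ℂ)‖ := norm_pos_iff.2 (by exact_mod_cast k.factorial_ne_zero)
    gcongr
    exact norm_poch_le_norm_poch_add hc n k

/-- **Gauss's summation theorem**. -/
theorem tsum_gaussCoeff {a b c : ℂ} (hc : 0 < c.re) (h : 0 < (c - a - b).re)
    (ha : ∀ n : ℕ, c - a ≠ -(n : ℂ)) (hb : ∀ n : ℕ, c - b ≠ -(n : ℂ)) :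
    ∑' n, gaussCoeff a b c n =
      Gamma c * Gamma (c - a - b) / (Gamma (c - a) * Gamma (c - b)) := by
  have hc' := ne_neg_natCast_of_re_pos hc
  have h' := ne_neg_natCast_of_re_pos h
  have t1 := ((GammaSeq_tendsto_Gamma c).mul (GammaSeq_tendsto_Gamma (c - a - b))).div
    ((GammaSeq_tendsto_Gamma (c - a)).mul (GammaSeq_tendsto_Gamma (c - b)))
    (mul_ne_zero (Gamma_ne_zero ha) (Gamma_ne_zero hb))
  have t2 := t1.mul ((tendsto_tsum_gaussCoeff_add_nat hc h).comp (tendsto_add_atTop_nat 1))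
  rw [mul_one] at t2
  refine tendsto_nhds_unique (tendsto_const_nhds.congr' ?_) t2
  filter_upwards [eventually_gt_atTop 0] with n hn
  have hn' : (n : ℂ) ≠ 0 := by exact_mod_cast hn.ne'
  have hf : (n.factorial : ℂ) ≠ 0 := by exact_mod_cast n.factorial_ne_zero
  rw [Function.comp_apply, tsum_gaussCoeff_add_nat hc h (n + 1)]
  congr 1
  simp only [Pi.div_apply, GammaSeq_eq_poch]
  have e : (n : ℂ) ^ (c - a) * (n : ℂ) ^ (c - b) = (n : ℂ) ^ c * (n : ℂ) ^ (c - a - b) := by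
    rw [← cpow_add _ _ hn', ← cpow_add _ _ hn']
    congr 1
    ring
  have p1 := poch_ne_zero ha (n + 1)
  have p2 := poch_ne_zero hb (n + 1)
  have p3 := poch_ne_zero hc' (n + 1)
  have p4 := poch_ne_zero h' (n + 1)
  have q1 : (n : ℂ) ^ (c - a) ≠ 0 := by simp [cpow_eq_zero_iff, hn']
  have q2 : (n : ℂ) ^ (c - b) ≠ 0 := by simp [cpow_eq_zero_iff, hn']
  have q3 : (n : ℂ) ^ c ≠ 0 := by simp [cpow_eq_zero_iff, hn']
  have q4 : (n : ℂ) ^ (c - a - b) ≠ 0 := by simp [cpow_eq_zero_iff, hn']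
  generalize (n : ℂ) ^ (c - a) = x1 at *
  generalize (n : ℂ) ^ (c - b) = x2 at *
  generalize (n : ℂ) ^ (c - a - b) = x4 at *
  generalize (n : ℂ) ^ c = x3 at *
  field_simp
  linear_combination e

/-- Domination of a power series with coefficients `O(n^(r-1))` by `(1 - y)^(-s)`. -/
lemma integrableOn_and_hasSum_integral_powerSeries {u : ℕ → ℂ} {r s : ℝ} (hs : 0 < s) (hr : r ≤ s)
    (hu : u =O[atTop] fun n : ℕ => (n : ℝ) ^ (r - 1)) {y : ℝ → ℝ} (hy : Continuous y)
    (hy01 : ∀ x ∈ Ioo (0 : ℝ) 1, 0 ≤ y x ∧ y x < 1) {G : ℝ → ℂ}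
    (hG : AEStronglyMeasurable G (volume.restrict (Ioo 0 1)))
    (hint : IntegrableOn (fun x => (1 - y x) ^ (-s) * ‖G x‖) (Ioo 0 1)) :
    IntegrableOn (fun x => (∑' n, u n * (y x : ℂ) ^ n) * G x) (Ioo 0 1) ∧
      HasSum (fun n => u n * ∫ x in Ioo (0 : ℝ) 1, (y x : ℂ) ^ n * G x)
        (∫ x in Ioo (0 : ℝ) 1, (∑' n, u n * (y x : ℂ) ^ n) * G x) := by
  obtain ⟨C, hC, hb⟩ := exists_bound_poch hs hr hu
  have hdom (x : ℝ) (hx : x ∈ Ioo (0 : ℝ) 1) :=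
    (hasSum_norm_poch hs (hy01 x hx).1 (hy01 x hx).2).mul_left C
  have hbound (x : ℝ) (hx : x ∈ Ioo (0 : ℝ) 1) (n : ℕ) : ‖u n * (y x : ℂ) ^ n‖ ≤
      C * (‖poch (s : ℂ) n‖ / n.factorial * y x ^ n) := by
    have := (hy01 x hx).1
    rw [norm_mul, norm_pow, norm_real, Real.norm_of_nonneg this, ← mul_assoc]
    gcongr
    exact hb n
  have hsum (x : ℝ) (hx : x ∈ Ioo (0 : ℝ) 1) :
      HasSum (fun n => u n * (y x : ℂ) ^ n) (∑' n, u n * (y x : ℂ) ^ n) :=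
    ((hdom x hx).summable.of_norm_bounded (hbound x hx)).hasSum
  have hmeas (n : ℕ) : AEStronglyMeasurable (fun x => u n * (y x : ℂ) ^ n * G x)
      (volume.restrict (Ioo 0 1)) :=
    AEStronglyMeasurable.mul (by fun_prop) hG
  have hmem : ∀ᵐ x ∂volume.restrict (Ioo (0 : ℝ) 1), x ∈ Ioo (0 : ℝ) 1 :=
    ae_restrict_mem measurableSet_Ioo
  constructor
  · refine Integrable.mono' (hint.const_mul C) (aestronglyMeasurable_of_tendsto_ae atTop
      (f := fun (N : ℕ) x => ∑ n ∈ Finset.range N, u n * (y x : ℂ) ^ n * G x)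
      (fun N => Finset.aestronglyMeasurable_fun_sum _ fun n _ => hmeas n) ?_) ?_
    · filter_upwards [hmem] with x hx
      exact ((hsum x hx).mul_right (G x)).tendsto_sum_nat
    · filter_upwards [hmem] with x hx
      rw [norm_mul, ← mul_assoc, ← (hdom x hx).tsum_eq]
      gcongr
      exact tsum_of_norm_bounded (hdom x hx).summable.hasSum (hbound x hx)
  · have := hasSum_integral_of_dominated_convergence
      (μ := volume.restrict (Ioo (0 : ℝ) 1)) (F := fun n x => u n * (y x : ℂ) ^ n * G x)
      (f := fun x => (∑' n, u n * (y x : ℂ) ^ n) * G x)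
      (fun n x => C * (‖poch (s : ℂ) n‖ / n.factorial * y x ^ n) * ‖G x‖) hmeas ?_ ?_ ?_ ?_
    · simpa only [mul_assoc, integral_const_mul] using this
    · intro n
      filter_upwards [hmem] with x hx
      rw [norm_mul]
      gcongr
      exact hbound x hx n
    · filter_upwards [hmem] with x hx
      exact (hdom x hx).summable.mul_right _
    · refine (hint.const_mul C).congr ?_
      filter_upwards [hmem] with x hx
      rw [tsum_mul_right, (hdom x hx).tsum_eq, mul_assoc]
    · filter_upwards [hmem] with x hx
      exact (hsum x hx).mul_right (G x)

/-- The integrand of the beta integral. -/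
def betaKernel (u v : ℂ) (x : ℝ) : ℂ := (x : ℂ) ^ (u - 1) * ((1 - x : ℝ) : ℂ) ^ (v - 1)

lemma integrableOn_betaKernel {u v : ℂ} (hu : 0 < u.re) (hv : 0 < v.re) :
    IntegrableOn (betaKernel u v) (Ioo 0 1) := by
  have h := betaIntegral_convergent hu hv
  rw [intervalIntegrable_iff_integrableOn_Ioo_of_le zero_le_one] at h
  exact h.congr_fun (fun x _ => by simp [betaKernel]) measurableSet_Ioo

lemma integral_betaKernel {u v : ℂ} (hu : 0 < u.re) (hv : 0 < v.re) :
    ∫ x in Ioo (0 : ℝ) 1, betaKernel u v x = Gamma u * Gamma v / Gamma (u + v) := by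
  rw [← betaIntegral_eq_Gamma_mul_div u v hu hv, betaIntegral,
    intervalIntegral.integral_of_le zero_le_one, integral_Ioc_eq_integral_Ioo]
  simp [betaKernel]

lemma cpow_mul_betaKernel {x : ℝ} (hx : x ∈ Ioo (0 : ℝ) 1) (w u v : ℂ) :
    (x : ℂ) ^ w * betaKernel u v x = betaKernel (u + w) v x := by
  have h : (x : ℂ) ≠ 0 := by exact_mod_cast hx.1.ne'
  rw [betaKernel, betaKernel, ← mul_assoc, ← cpow_add _ _ h]
  ring_nf

lemma one_sub_cpow_mul_betaKernel {x : ℝ} (hx : x ∈ Ioo (0 : ℝ) 1) (w u v : ℂ) :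
    ((1 - x : ℝ) : ℂ) ^ w * betaKernel u v x = betaKernel u (v + w) x := by
  have h : ((1 - x : ℝ) : ℂ) ≠ 0 := by exact_mod_cast (sub_pos.2 hx.2).ne'
  rw [betaKernel, betaKernel, mul_left_comm, ← cpow_add _ _ h]
  ring_nf

lemma rpow_mul_norm_betaKernel {x : ℝ} (hx : x ∈ Ioo (0 : ℝ) 1) (w : ℝ) (u v : ℂ) :
    x ^ w * ‖betaKernel u v x‖ = ‖betaKernel (u + w) v x‖ := by
  rw [← cpow_mul_betaKernel hx, norm_mul, norm_cpow_eq_rpow_re_of_pos hx.1, ofReal_re]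

lemma one_sub_rpow_mul_norm_betaKernel {x : ℝ} (hx : x ∈ Ioo (0 : ℝ) 1) (w : ℝ) (u v : ℂ) :
    (1 - x) ^ w * ‖betaKernel u v x‖ = ‖betaKernel u (v + w) x‖ := by
  rw [← one_sub_cpow_mul_betaKernel hx, norm_mul,
    norm_cpow_eq_rpow_re_of_pos (sub_pos.2 hx.2), ofReal_re]

lemma integrableOn_and_hasSum_integral_hyp2F1 {a b c s v : ℂ} (hc : ∀ n : ℕ, c ≠ -(n : ℂ))
    (hs : 0 < s.re) (hv : 0 < v.re) (h : 0 < (s + c - a - b).re) :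
    IntegrableOn (fun x : ℝ => hyp2F1 a b c (1 - x) * betaKernel s v x) (Ioo 0 1) ∧
      HasSum (fun n => gaussCoeff a b c n *
          ∫ x in Ioo (0 : ℝ) 1, ((1 - x : ℝ) : ℂ) ^ n * betaKernel s v x)
        (∫ x in Ioo (0 : ℝ) 1, hyp2F1 a b c (1 - x) * betaKernel s v x) := by
  set e : ℝ := max (s.re / 2) (a + b - c).re
  have he0 : 0 < e := lt_max_of_lt_left (by linarith)
  have hes : e < s.re := max_lt (by linarith) (by simp at h ⊢; linarith)
  have := integrableOn_and_hasSum_integral_powerSeries he0 (le_max_right _ _)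
    (gaussCoeff_isBigO a b hc) (y := fun x => 1 - x) (by fun_prop)
    (fun x hx => ⟨by linarith [hx.2], by linarith [hx.1]⟩)
    (integrableOn_betaKernel hs hv).aestronglyMeasurable ?_
  · simpa [hyp2F1, gaussCoeff] using this
  · have hK : IntegrableOn (fun x => ‖betaKernel (s - e) v x‖) (Ioo 0 1) :=
      (integrableOn_betaKernel (by simpa using hes) hv).norm
    refine hK.congr_fun (fun x hx => ?_) measurableSet_Ioo
    simp only [sub_sub_cancel]
    rw [rpow_mul_norm_betaKernel hx, ofReal_neg, sub_eq_add_neg]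

/-- The beta transform of a Gauss hypergeometric function. -/
lemma integral_hyp2F1_mul_betaKernel {a b c s : ℂ} (hc : 0 < c.re) (hs : 0 < s.re)
    (h : 0 < (s + c - a - b).re) (ha : ∀ n : ℕ, s + c - a ≠ -(n : ℂ))
    (hb : ∀ n : ℕ, s + c - b ≠ -(n : ℂ)) :
    ∫ x in Ioo (0 : ℝ) 1, hyp2F1 a b c (1 - x) * betaKernel s c x =
      Gamma c * Gamma s * Gamma (s + c - a - b) /
        (Gamma (s + c - a) * Gamma (s + c - b)) := by
  have hc' := ne_neg_natCast_of_re_pos hc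
  have hsc : 0 < (s + c).re := by simp; linarith
  have hsc' := ne_neg_natCast_of_re_pos hsc
  have H := (integrableOn_and_hasSum_integral_hyp2F1 hc' hs hc h).2
  rw [← H.tsum_eq]
  have hterm (n : ℕ) : gaussCoeff a b c n *
      ∫ x in Ioo (0 : ℝ) 1, ((1 - x : ℝ) : ℂ) ^ n * betaKernel s c x =
        Gamma c * Gamma s / Gamma (s + c) * gaussCoeff a b (s + c) n := by
    have e : ∫ x in Ioo (0 : ℝ) 1, ((1 - x : ℝ) : ℂ) ^ n * betaKernel s c x =
        ∫ x in Ioo (0 : ℝ) 1, betaKernel s (c + n) x := by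
      refine setIntegral_congr_fun measurableSet_Ioo fun x hx => ?_
      simp only [← one_sub_cpow_mul_betaKernel hx, cpow_natCast]
    rw [e, integral_betaKernel hs (by simp; positivity), ← add_assoc, Gamma_add_natCast hc',
      Gamma_add_natCast hsc']
    have h1 := poch_ne_zero hc' n
    have h2 := poch_ne_zero hsc' n
    have h3 := Gamma_ne_zero hsc'
    simp only [gaussCoeff]
    field_simp
  simp only [hterm]
  rw [tsum_mul_left, tsum_gaussCoeff hsc h ha hb]
  have h3 := Gamma_ne_zero hsc'
  have h4 := Gamma_ne_zero ha
  have h5 := Gamma_ne_zero hb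
  field_simp

/-- The integral of `x^(s-1) (1-x)^(c-d-1) ₂F₁(a,b;c;1-x)` as a `₃F₂` series at `1`. -/
lemma integrableOn_and_integral_eq_hyp3F2 {a b c d s : ℂ} (hc : 0 < c.re) (hs : 0 < s.re)
    (hd : d.re < c.re) (h : 0 < (s + c - a - b).re) (ha : ∀ n : ℕ, s + c - a ≠ -(n : ℂ))
    (hb : ∀ n : ℕ, s + c - b ≠ -(n : ℂ)) :
    IntegrableOn (fun x : ℝ => hyp2F1 a b c (1 - x) * betaKernel s (c - d) x) (Ioo 0 1) ∧
    ∫ x in Ioo (0 : ℝ) 1, hyp2F1 a b c (1 - x) * betaKernel s (c - d) x =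
      Gamma c * Gamma s * Gamma (s + c - a - b) / (Gamma (s + c - a) * Gamma (s + c - b)) *
        hyp3F2 s (s + c - a - b) d (s + c - b) (s + c - a) := by
  have hc' := ne_neg_natCast_of_re_pos hc
  refine ⟨(integrableOn_and_hasSum_integral_hyp2F1 hc' hs (by simpa using hd) h).1, ?_⟩
  set e : ℝ := max (c.re / 2) d.re
  have he0 : 0 < e := lt_max_of_lt_left (by linarith)
  have hec : e < c.re := max_lt (by linarith) hd
  have hG := (integrableOn_and_hasSum_integral_hyp2F1 hc' hs hc h).1
  have hG' := (integrableOn_and_hasSum_integral_hyp2F1 (v := c - e) hc' hs (by simpa using hec) h).1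
  have hu : (fun n => poch d n / (n.factorial : ℂ)) =O[atTop]
      fun n : ℕ => (n : ℝ) ^ (d.re - 1) := by
    refine (gaussCoeff_isBigO d 1 one_ne_neg_natCast).congr (fun n => ?_) (fun n => by simp)
    rw [gaussCoeff, poch_one, mul_comm, mul_div_mul_left]
    exact_mod_cast n.factorial_ne_zero
  have H := (integrableOn_and_hasSum_integral_powerSeries he0 (le_max_right _ _) hu
    (y := fun x => x) continuous_id (fun x hx => ⟨hx.1.le, hx.2⟩) hG.aestronglyMeasurable ?_).2
  · have e1 : ∫ x in Ioo (0 : ℝ) 1, hyp2F1 a b c (1 - x) * betaKernel s (c - d) x =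
        ∫ x in Ioo (0 : ℝ) 1, (∑' n : ℕ, poch d n / (n.factorial : ℂ) * (x : ℂ) ^ n) *
          (hyp2F1 a b c (1 - x) * betaKernel s c x) := by
      refine setIntegral_congr_fun measurableSet_Ioo fun x hx => ?_
      simp only [(hasSum_poch d hx.1.le hx.2).tsum_eq]
      rw [mul_left_comm, one_sub_cpow_mul_betaKernel hx, sub_eq_add_neg c d]
    rw [e1, ← H.tsum_eq, hyp3F2, ← tsum_mul_left]
    refine tsum_congr fun n => ?_
    have e2 : ∫ x in Ioo (0 : ℝ) 1, (x : ℂ) ^ n * (hyp2F1 a b c (1 - x) * betaKernel s c x) =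
        ∫ x in Ioo (0 : ℝ) 1, hyp2F1 a b c (1 - x) * betaKernel (s + n) c x := by
      refine setIntegral_congr_fun measurableSet_Ioo fun x hx => ?_
      simp only [← cpow_mul_betaKernel hx, cpow_natCast]
      ring
    have shift (w : ℂ) (hw : ∀ n : ℕ, w ≠ -(n : ℂ)) (k : ℕ) : w + n ≠ -(k : ℂ) := fun h0 =>
      hw (k + n) (by push_cast; linear_combination h0)
    have r1 : s + n + c - a - b = s + c - a - b + n := by ring
    have r2 : s + n + c - a = s + c - a + n := by ring
    have r3 : s + n + c - b = s + c - b + n := by ring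
    rw [e2, integral_hyp2F1_mul_betaKernel hc (by simp; positivity)
      (by rw [r1, add_re, natCast_re]; positivity) (by rw [r2]; exact shift _ ha)
      (by rw [r3]; exact shift _ hb), r1, r2, r3, Gamma_add_natCast ha, Gamma_add_natCast hb,
      Gamma_add_natCast (ne_neg_natCast_of_re_pos hs),
      Gamma_add_natCast (ne_neg_natCast_of_re_pos h)]
    have p1 := poch_ne_zero ha n
    have p2 := poch_ne_zero hb n
    have q1 := Gamma_ne_zero ha
    have q2 := Gamma_ne_zero hb
    field_simp
  · refine IntegrableOn.congr_fun (Integrable.norm hG') (fun x hx => ?_) measurableSet_Ioo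
    simp only [norm_mul]
    rw [mul_left_comm, one_sub_rpow_mul_norm_betaKernel hx, ofReal_neg, ← sub_eq_add_neg]

theorem stmt18 (p q : ℝ) (hp : -1 < p) (lam₁ lam₂ : ℂ)
    (h1 : (1 + p + q) / 2 < lam₁.re) (h2 : lam₂.re < 1 + p)
    (h3 : ∀ n : ℕ, lam₁ ≠ -(n : ℂ)) (h4 : ∀ n : ℕ, lam₁ - (q : ℂ) ≠ -(n : ℂ))
    (α : ℂ) (hα : α.re = 0) :
    IntegrableOn (fun x : ℝ =>
        wpq p q x * (x : ℂ) ^ lam₁ * ((1 - x : ℝ) : ℂ) ^ (-lam₂) *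
          thetaJ (p : ℂ) (q : ℂ) α x) (Ioo 0 1) ∧
    ∫ x in Ioo (0 : ℝ) 1,
        wpq p q x * (x : ℂ) ^ lam₁ * ((1 - x : ℝ) : ℂ) ^ (-lam₂) *
          thetaJ (p : ℂ) (q : ℂ) α x
      = Complex.Gamma (1 + (p : ℂ)) *
          Complex.Gamma (lam₁ - ((1 + p + q : ℝ) : ℂ) / 2 + α) *
          Complex.Gamma (lam₁ - ((1 + p + q : ℝ) : ℂ) / 2 - α) /
          (Complex.Gamma lam₁ * Complex.Gamma (lam₁ - (q : ℂ))) *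
          hyp3F2 (lam₁ - ((1 + p + q : ℝ) : ℂ) / 2 + α) (lam₁ - ((1 + p + q : ℝ) : ℂ) / 2 - α)
            lam₂ lam₁ (lam₁ - (q : ℂ)) := by
  have ec : (1 + (p : ℂ)).re = 1 + p := by simp
  have key : ∀ x ∈ Ioo (0 : ℝ) 1, hyp2F1 ((1 + p + q) / 2 + α) ((1 + p - q) / 2 + α) (1 + p)
        (1 - (x : ℂ)) * betaKernel (lam₁ - ((1 + p + q : ℝ) : ℂ) / 2 + α) (1 + p - lam₂) x =
      wpq p q x * (x : ℂ) ^ lam₁ * ((1 - x : ℝ) : ℂ) ^ (-lam₂) *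
        thetaJ (p : ℂ) (q : ℂ) α x := by
    intro x hx
    have hx0 : (x : ℂ) ≠ 0 := by exact_mod_cast hx.1.ne'
    have hx1 : ((1 - x : ℝ) : ℂ) ≠ 0 := by exact_mod_cast (sub_pos.2 hx.2).ne'
    have e1 : (x : ℂ) ^ (lam₁ - ((1 + p + q : ℝ) : ℂ) / 2 + α - 1) =
        (x : ℂ) ^ ((-(2 + p + q) : ℝ) : ℂ) * (x : ℂ) ^ lam₁ *
          (x : ℂ) ^ ((1 + (p : ℂ) + q) / 2 + α) := by
      rw [← cpow_add _ _ hx0, ← cpow_add _ _ hx0]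
      congr 1
      push_cast
      ring
    have e2 : ((1 - x : ℝ) : ℂ) ^ (1 + (p : ℂ) - lam₂ - 1) =
        ((1 - x : ℝ) : ℂ) ^ (p : ℂ) * ((1 - x : ℝ) : ℂ) ^ (-lam₂) := by
      rw [← cpow_add _ _ hx1]
      congr 1
      ring
    rw [betaKernel, e1, e2, wpq, thetaJ]
    ring
  have r1 : lam₁ - ((1 + p + q : ℝ) : ℂ) / 2 + α + (1 + p) - ((1 + p + q) / 2 + α) =
      lam₁ - q := by push_cast; ring
  have r2 : lam₁ - ((1 + p + q : ℝ) : ℂ) / 2 + α + (1 + p) - ((1 + p - q) / 2 + α) =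
      lam₁ := by push_cast; ring
  have r3 : lam₁ - q - ((1 + p - q) / 2 + α) = lam₁ - ((1 + p + q : ℝ) : ℂ) / 2 - α := by
    push_cast; ring
  have hre : ((((1 + p + q : ℝ) : ℂ)) / 2).re = (1 + p + q) / 2 := by
    rw [← ofReal_ofNat, ← ofReal_div, ofReal_re]
  have H := integrableOn_and_integral_eq_hyp3F2 (a := (1 + p + q) / 2 + α)
    (b := (1 + p - q) / 2 + α) (c := 1 + p) (d := lam₂)
    (s := lam₁ - ((1 + p + q : ℝ) : ℂ) / 2 + α) (by rw [ec]; linarith)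
    (by rw [add_re, sub_re, hre, hα]; linarith) (by rw [ec]; exact h2)
    (by rw [r1, r3, sub_re, sub_re, hre, hα]; linarith) (by rw [r1]; exact h4)
    (by rw [r2]; exact h3)
  rw [r1, r2, r3] at H
  refine ⟨H.1.congr_fun key measurableSet_Ioo, ?_⟩
  rw [← setIntegral_congr_fun measurableSet_Ioo key, H.2, mul_comm (Gamma lam₁)]
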